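/- Let σ be a conjugate-linear involution of g with σ(h) = h and σ*(Δ) = −Δ. Then μ := −σ*|_Δ is a diagram automorphism of order 1 or 2 of Δ, and there exist a choice of root vectors e_α ∈ g_α \ {0} with B(e_α, e_{−α}) = 1 for all α ∈ Φ and a subset T̃ of Φ^μ (the set of roots fixed by the ℤ-linear extension of μ) such that σ(e_α) = (−1)^{χ_{T̃}(α)} e_{−μ(α)} for all α ∈ Φ, where χ_{T̃} is the characteristic function of T̃; moreover σ(h_α) = −h_{μ(α)} for all α ∈ Φ, and neither μ nor T̃ depends on the choice of the root vectors. -/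

import Mathlib

open TensorProduct

set_option linter.unusedVariables false

/-- The root space of `α` relative to the subalgebra `H`:
all `x ∈ L` with `⁅y, x⁆ = α y • x` for every `y ∈ H`. -/
def rootSpace' {L : Type*} [LieRing L] [LieAlgebra ℂ L]
    (H : LieSubalgebra ℂ L) (α : Module.Dual ℂ H) : Submodule ℂ L where
  carrier := {x | ∀ y : H, ⁅(y : L), x⁆ = α y • x}
  add_mem' := by
    intro a b ha hb y
    rw [lie_add, ha y, hb y, smul_add]
  zero_mem' := by
    intro y
    rw [lie_zero, smul_zero]
  smul_mem' := by
    intro c x hx y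
    rw [lie_smul, hx y, smul_comm]

section RootSpaces

open LieAlgebra LieAlgebra.IsKilling LieModule

variable {L : Type*} [LieRing L] [LieAlgebra ℂ L] [FiniteDimensional ℂ L]

/-- A conjugate-linear involutive automorphism conjugates the values of the Killing form. -/
theorem killingForm_conjLinear_involution (σ : L → L)
    (hσadd : ∀ x y, σ (x + y) = σ x + σ y)
    (hσsmul : ∀ (z : ℂ) (x : L), σ (z • x) = (starRingEnd ℂ) z • σ x)
    (hσσ : ∀ x, σ (σ x) = x)
    (hσlie : ∀ x y : L, σ ⁅x, y⁆ = ⁅σ x, σ y⁆) (x y : L) :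
    killingForm ℂ L (σ x) (σ y) = (starRingEnd ℂ) (killingForm ℂ L x y) := by
  let b := Module.finBasis ℂ L
  let E : L ≃ₗ[ℂ] (Fin (Module.finrank ℂ L) → ℂ) :=
    { toFun := fun v i => (starRingEnd ℂ) (b.equivFun (σ v) i)
      map_add' := by intro u v; ext i; simp [hσadd]
      map_smul' := by intro c v; ext i; simp [hσsmul]
      invFun := fun w => σ (b.equivFun.symm fun i => (starRingEnd ℂ) (w i))
      left_inv := by intro v; simp only [Complex.conj_conj]; simp [hσσ]
      right_inv := by intro w; simp only [hσσ, LinearEquiv.apply_symm_apply, Complex.conj_conj] }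
  let b' := Module.Basis.ofEquivFun E
  have hb' : ∀ i, b' i = σ (b i) := by
    intro i
    apply E.injective
    ext j
    simp only [b', Module.Basis.coe_ofEquivFun, LinearEquiv.apply_symm_apply]
    simp [E, hσσ, Finsupp.single_apply, Pi.single_apply, eq_comm]
  have hr : ∀ v i, b'.repr v i = (starRingEnd ℂ) (b.repr (σ v) i) := by
    intro v i
    rfl
  rw [killingForm_apply_apply, killingForm_apply_apply, LinearMap.trace_eq_matrix_trace ℂ b',
    LinearMap.trace_eq_matrix_trace ℂ b]
  simp only [Matrix.trace, Matrix.diag_apply, LinearMap.toMatrix_apply, map_sum]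
  refine Finset.sum_congr rfl fun i _ => ?_
  simp [hr, hb', hσlie, hσσ]

variable [IsKilling ℂ L] (H : LieSubalgebra ℂ L) [H.IsCartanSubalgebra]

theorem mem_rootSpace'_iff {α : Module.Dual ℂ H} {x : L} :
    x ∈ rootSpace' H α ↔ x ∈ rootSpace H α := by
  refine ⟨fun hx => (mem_genWeightSpace L α x).mpr fun y => ⟨1, ?_⟩, fun hx y => ?_⟩
  · have := hx y
    simpa [sub_eq_zero] using! this
  · exact lie_eq_smul_of_mem_rootSpace hx y

theorem exists_weight_of_rootSpace'_ne_bot {α : Module.Dual ℂ H} (h0 : α ≠ 0)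
    (hα : rootSpace' H α ≠ ⊥) :
    ∃ χ : Weight ℂ H L, χ.IsNonZero ∧ χ.toLinear = α := by
  obtain ⟨x, hx, hx0⟩ := (Submodule.ne_bot_iff _).mp hα
  have hne : rootSpace H α ≠ ⊥ := fun h => hx0 (by
    have := (mem_rootSpace'_iff H).mp hx
    rw [h] at this
    simpa using this)
  refine ⟨⟨α, hne⟩, fun h => h0 ?_, ?_⟩
  · ext y
    exact congrFun h y
  · ext y
    rfl

theorem exists_eq_smul_of_mem_rootSpace' {α : Module.Dual ℂ H} (h0 : α ≠ 0) {x y : L}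
    (hx : x ∈ rootSpace' H α) (hx0 : x ≠ 0) (hy : y ∈ rootSpace' H α) :
    ∃ c : ℂ, y = c • x := by
  obtain ⟨χ, hχ, rfl⟩ := exists_weight_of_rootSpace'_ne_bot H h0
    ((Submodule.ne_bot_iff _).mpr ⟨x, hx, hx0⟩)
  have hV : rootSpace' H χ.toLinear = (rootSpace H χ).toSubmodule := by
    ext z
    exact mem_rootSpace'_iff H
  have hf : Module.finrank ℂ (rootSpace' H χ.toLinear) = 1 := by
    rw [hV]
    exact finrank_rootSpace_eq_one χ hχ
  obtain ⟨c, hc⟩ := exists_smul_eq_of_finrank_eq_one hf (x := ⟨x, hx⟩)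
    (fun h => hx0 (congrArg Subtype.val h)) ⟨y, hy⟩
  exact ⟨c, (congrArg Subtype.val hc).symm⟩

theorem killingForm_ne_zero_of_mem_rootSpace' {α : Module.Dual ℂ H} (h0 : α ≠ 0) {x y : L}
    (hx : x ∈ rootSpace' H α) (hx0 : x ≠ 0) (hy : y ∈ rootSpace' H (-α)) (hy0 : y ≠ 0) :
    killingForm ℂ L x y ≠ 0 := by
  intro h
  apply hx0
  rw [← Submodule.mem_bot (R := ℂ), ← ker_killingForm_eq_bot ℂ L]
  refine mem_ker_killingForm_of_mem_rootSpace_of_forall_rootSpace_neg ℂ L H (α := α)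
    ((mem_rootSpace'_iff H).mp hx) fun z hz => ?_
  obtain ⟨c, rfl⟩ := exists_eq_smul_of_mem_rootSpace' H (neg_ne_zero.mpr h0) hy hy0
    ((mem_rootSpace'_iff H (α := -α)).mpr hz)
  simp [h]

/-- The inner products of roots are real. -/
theorem conj_weight_apply_cartanEquivDual_symm (χ ψ : Weight ℂ H L) (hχ : χ.IsNonZero) :
    (starRingEnd ℂ) (ψ ((cartanEquivDual H).symm χ)) = ψ ((cartanEquivDual H).symm χ) := by
  set h := (cartanEquivDual H).symm χ
  set N := χ h with hN_def
  have hN : N ≠ 0 := root_apply_cartanEquivDual_symm_ne_zero hχ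
  have hh : h = (N / 2) • coroot χ := by
    simp only [coroot, ← Nat.cast_smul_eq_nsmul ℂ, smul_smul]
    change h = (N / 2 * ((2 : ℕ) * N⁻¹)) • h
    rw [show N / 2 * (((2 : ℕ) : ℂ) * N⁻¹) = 1 by push_cast; field_simp, one_smul]
  have hint : ∀ φ : Weight ℂ H L, ∃ n : ℤ, φ h = N / 2 * n := by
    intro φ
    refine ⟨chainBotCoeff χ φ - chainTopCoeff χ φ, ?_⟩
    rw [hh, ← Weight.toLinear_apply, map_smul, Weight.toLinear_apply, apply_coroot_eq_cast,
      smul_eq_mul]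
  choose n hn using hint
  have hsum : N = N ^ 2 / 4 * ((∑ φ ∈ H.root, n φ ^ 2 : ℤ) : ℂ) := by
    have h1 : killingForm ℂ L h h = N := by
      have : cartanEquivDual H h h = χ h := by
        simp [h]
      exact this
    have h2 := congrArg (fun f => f h h) (restrict_killingForm_eq_sum (K := ℂ) (H := H))
    simp only [LinearMap.sum_apply, LinearMap.smulRight_apply, LinearMap.smul_apply,
      smul_eq_mul] at h2
    change killingForm ℂ L h h = _ at h2
    rw [h1] at h2
    refine h2.trans ?_
    push_cast
    rw [Finset.mul_sum]
    refine Finset.sum_congr rfl fun φ _ => ?_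
    have hφ : Weight.toLinear ℂ H L φ h = N / 2 * n φ := hn φ
    rw [hφ]
    ring
  have hNr : (starRingEnd ℂ) N = N := by
    have h4 : N * ((∑ φ ∈ H.root, n φ ^ 2 : ℤ) : ℂ) = 4 := by
      apply mul_left_cancel₀ hN
      linear_combination (-4) * hsum
    have hS : ((∑ φ ∈ H.root, n φ ^ 2 : ℤ) : ℂ) ≠ 0 := by
      intro h0
      rw [h0] at h4
      norm_num at h4
    rw [eq_div_of_mul_eq hS h4, map_div₀, map_intCast, map_ofNat]
  rw [hn ψ, map_mul, map_div₀, map_intCast, map_ofNat, hNr]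

end RootSpaces


open scoped Classical in
theorem statement2
    {L : Type*} [LieRing L] [LieAlgebra ℂ L] [FiniteDimensional ℂ L]
    [LieAlgebra.IsSimple ℂ L]
    -- `H` is a Cartan subalgebra of the simple complex Lie algebra `L`
    (H : LieSubalgebra ℂ L) [LieSubalgebra.IsCartanSubalgebra H]
    -- `Φ` is the set of roots of `L` relative to `H`
    (Φ : Set (Module.Dual ℂ H))
    (hΦ : ∀ α : Module.Dual ℂ H, α ∈ Φ ↔ α ≠ 0 ∧ rootSpace' H α ≠ ⊥)
    (hΦneg : ∀ γ ∈ Φ, -γ ∈ Φ)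
    -- `hvec lam` is the element `h_lam ∈ H` representing `lam` via the Killing form
    (hvec : Module.Dual ℂ H → H)
    (hhvec : ∀ (lam : Module.Dual ℂ H) (x : H),
      killingForm ℂ L (hvec lam : L) (x : L) = lam x)
    -- `Δ` is a system of simple roots for `Φ`
    (Δ : Finset (Module.Dual ℂ H)) (hΔΦ : ↑Δ ⊆ Φ)
    (hind : LinearIndependent ℂ (fun b : {x // x ∈ Δ} => (b : Module.Dual ℂ H)))
    (hbase : ∀ γ ∈ Φ, ∃ k : Module.Dual ℂ H → ℤ,
      ((∀ b ∈ Δ, 0 ≤ k b) ∨ (∀ b ∈ Δ, k b ≤ 0)) ∧ γ = ∑ b ∈ Δ, k b • b)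
    -- `σ` is a conjugate-linear Lie algebra involution of `L`
    (σ : L → L)
    (hσadd : ∀ x y, σ (x + y) = σ x + σ y)
    (hσsmul : ∀ (z : ℂ) (x : L), σ (z • x) = (starRingEnd ℂ) z • σ x)
    (hσσ : ∀ x, σ (σ x) = x)
    (hσlie : ∀ x y : L, σ ⁅x, y⁆ = ⁅σ x, σ y⁆)
    (hσH : ∀ x : H, σ (x : L) ∈ H)
    -- `σstar` is the adjoint of `σ` on the dual of `H`: `σstar lam x = conj (lam (σ x))`
    (σstar : Module.Dual ℂ H → Module.Dual ℂ H)
    (hσstar : ∀ (lam : Module.Dual ℂ H) (x : H),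
      σstar lam x = (starRingEnd ℂ) (lam ⟨σ (x : L), hσH x⟩))
    -- hypothesis: `σ*(Δ) = -Δ`, i.e. `μ := -σ*` maps `Δ` onto `Δ`
    (hstarΔ : (fun lam => -(σstar lam)) '' ↑Δ = ↑Δ) :
    -- `μ := -σ*|_Δ` is a diagram automorphism of order 1 or 2 ...
    Set.BijOn (fun lam => -(σstar lam)) ↑Δ ↑Δ ∧
    (∀ b ∈ Δ, -(σstar (-(σstar b))) = b) ∧
    (∀ a ∈ Δ, ∀ b ∈ Δ,
      killingForm ℂ L (hvec (-(σstar a)) : L) (hvec (-(σstar b)) : L)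
        = killingForm ℂ L (hvec a : L) (hvec b : L)) ∧
    -- ... `σ (h_α) = -h_{μ α}` for all roots `α` (note `-μ α = σstar α`) ...
    (∀ α ∈ Φ, σ (hvec α : L) = -(hvec (-(σstar α)) : L)) ∧
    -- ... and there are a choice of root vectors and a subset `T` of `Φ^μ` with
    -- `σ (e α) = (-1) ^ (χ_T α) • e (-μ α)` for all `α ∈ Φ`, `T` being independent
    -- of the choice of root vectors.
    ∃ (e : Module.Dual ℂ H → L) (T : Set (Module.Dual ℂ H)),
      (∀ α ∈ Φ, e α ∈ rootSpace' H α ∧ e α ≠ 0) ∧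
      (∀ α ∈ Φ, killingForm ℂ L (e α) (e (-α)) = 1) ∧
      T ⊆ {γ ∈ Φ | -(σstar γ) = γ} ∧
      (∀ α ∈ Φ, σ (e α) = (if α ∈ T then (-1 : ℂ) else 1) • e (σstar α)) ∧
      (∀ (e' : Module.Dual ℂ H → L) (T' : Set (Module.Dual ℂ H)),
        (∀ α ∈ Φ, e' α ∈ rootSpace' H α ∧ e' α ≠ 0) →
        (∀ α ∈ Φ, killingForm ℂ L (e' α) (e' (-α)) = 1) →
        T' ⊆ {γ ∈ Φ | -(σstar γ) = γ} →
        (∀ α ∈ Φ, σ (e' α) = (if α ∈ T' then (-1 : ℂ) else 1) • e' (σstar α)) →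
        T' = T) := by
  have hstar_add : ∀ l m, σstar (l + m) = σstar l + σstar m := by
    intro l m
    ext x
    simp [hσstar]
  have hstar_neg : ∀ l, σstar (-l) = -σstar l := by
    intro l
    ext x
    simp [hσstar]
  have hstar_star : ∀ l, σstar (σstar l) = l := by
    intro l
    ext x
    simp [hσstar, hσσ]
  have hmem : ∀ α x, x ∈ rootSpace' H α → σ x ∈ rootSpace' H (σstar α) := by
    intro α x hx y
    have h1 := hx ⟨σ y, hσH y⟩
    have h2 := congrArg σ h1
    rw [hσlie, hσσ, hσsmul] at h2
    rw [h2, hσstar]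
  have hσ0 : σ 0 = 0 := by simpa using hσadd 0 0
  have hσne : ∀ x, x ≠ 0 → σ x ≠ 0 := by
    intro x hx h
    exact hx (by rw [← hσσ x, h, hσ0])
  have hΦ0 : ∀ α ∈ Φ, α ≠ 0 := fun α hα => ((hΦ α).mp hα).1
  have hΦstar : ∀ α ∈ Φ, σstar α ∈ Φ := by
    intro α hα
    obtain ⟨h0, h1⟩ := (hΦ α).mp hα
    obtain ⟨x, hx, hx0⟩ := (Submodule.ne_bot_iff _).mp h1
    refine (hΦ _).mpr ⟨fun h => h0 ?_, (Submodule.ne_bot_iff _).mpr ⟨_, hmem α x hx, hσne x hx0⟩⟩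
    have h2 := hstar_add 0 0
    rw [add_zero, left_eq_add] at h2
    rw [← hstar_star α, h, h2]
  have hkill := killingForm_conjLinear_involution σ hσadd hσsmul hσσ hσlie
  have hvec_eq : ∀ l, hvec l = (LieAlgebra.IsKilling.cartanEquivDual H).symm l := by
    intro l
    rw [LinearEquiv.eq_symm_apply]
    ext x
    exact hhvec l x
  have hvec_neg : ∀ l, hvec (-l) = -hvec l := by
    intro l
    rw [hvec_eq, hvec_eq, map_neg]
  have hσvec : ∀ l, σ (hvec l : L) = hvec (σstar l) := by
    intro l
    have h1 : (⟨σ (hvec l : L), hσH _⟩ : H) = hvec (σstar l) := by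
      rw [hvec_eq (σstar l), LinearEquiv.eq_symm_apply]
      ext x
      change killingForm ℂ L (σ (hvec l : L)) (x : L) = _
      rw [hσstar, ← hhvec l, ← hkill]
      simp only [hσσ]
    exact congrArg Subtype.val h1
  have hreal : ∀ a ∈ Φ, ∀ b ∈ Φ, (starRingEnd ℂ) (killingForm ℂ L (hvec a : L) (hvec b : L)) =
      killingForm ℂ L (hvec a : L) (hvec b : L) := by
    intro a ha b hb
    obtain ⟨χ, hχ, rfl⟩ := exists_weight_of_rootSpace'_ne_bot H (hΦ0 a ha) ((hΦ a).mp ha).2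
    obtain ⟨ψ, hψ, rfl⟩ := exists_weight_of_rootSpace'_ne_bot H (hΦ0 b hb) ((hΦ b).mp hb).2
    rw [hhvec, hvec_eq]
    exact conj_weight_apply_cartanEquivDual_symm H ψ χ hψ
  have hμμ : ∀ b, -(σstar (-(σstar b))) = b := by
    intro b
    rw [hstar_neg, hstar_star, neg_neg]
  have hμΔ : ∀ b ∈ Δ, -(σstar b) ∈ Δ := by
    intro b hb
    have : -(σstar b) ∈ (fun lam => -(σstar lam)) '' (↑Δ : Set (Module.Dual ℂ H)) := ⟨b, hb, rfl⟩
    rw [hstarΔ] at this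
    exact this
  refine ⟨⟨fun b hb => hμΔ b hb, ?_, hstarΔ.ge⟩, fun b _ => hμμ b, ?_, ?_, ?_⟩
  · intro a _ b _ hab
    rw [← hμμ a, ← hμμ b]
    exact congrArg (fun l => -(σstar l)) hab
  · intro a ha b hb
    rw [hvec_neg, hvec_neg, ← hreal a (hΔΦ ha) b (hΔΦ hb), ← hkill, hσvec, hσvec]
    simp
  · intro α _
    rw [hvec_neg, hσvec]
    simp
  let Pos : Module.Dual ℂ H → Prop := fun γ =>
    ∃ k : Module.Dual ℂ H → ℤ, (∀ b ∈ Δ, 0 ≤ k b) ∧ γ = ∑ b ∈ Δ, k b • b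
  have pos_or : ∀ γ ∈ Φ, Pos γ ∨ Pos (-γ) := by
    intro γ hγ
    obtain ⟨k, hk, rfl⟩ := hbase γ hγ
    rcases hk with hk | hk
    · exact Or.inl ⟨k, hk, rfl⟩
    · exact Or.inr ⟨fun b => -k b, fun b hb => by simpa using hk b hb, by simp⟩
  have not_pos_neg : ∀ γ ∈ Φ, Pos γ → ¬ Pos (-γ) := by
    rintro γ hγ ⟨k, hk, h1⟩ ⟨k', hk', h2⟩
    apply hΦ0 γ hγ
    have h3 : ∑ b ∈ Δ, ((k b + k' b : ℤ) : ℂ) • b = 0 := by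
      simp only [Int.cast_smul_eq_zsmul, add_smul, Finset.sum_add_distrib]
      rw [← h1, ← h2, add_neg_cancel]
    rw [← Finset.sum_coe_sort Δ (fun b => ((k b + k' b : ℤ) : ℂ) • b)] at h3
    have h4 := Fintype.linearIndependent_iff.mp hind _ h3
    rw [h1]
    refine Finset.sum_eq_zero fun b hb => ?_
    have h5 := h4 ⟨b, hb⟩
    have h6 : k b + k' b = 0 := by exact_mod_cast h5
    have h7 : k b = 0 := by linarith [hk b hb, hk' b hb]
    rw [h7, zero_smul]
  have pos_μ : ∀ γ, Pos γ → Pos (-(σstar γ)) := by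
    rintro γ ⟨k, hk, rfl⟩
    refine ⟨fun b => k (-(σstar b)), fun b hb => hk _ (hμΔ b hb), ?_⟩
    have h1 : -(σstar (∑ b ∈ Δ, k b • b)) = ∑ b ∈ Δ, k b • -(σstar b) := by
      have := map_sum (-AddMonoidHom.mk' σstar hstar_add) (fun b => k b • b) Δ
      simpa only [map_zsmul, AddMonoidHom.neg_apply, AddMonoidHom.mk'_apply] using this
    rw [h1]
    refine Finset.sum_nbij' (fun b => -(σstar b)) (fun b => -(σstar b)) hμΔ hμΔ
      (fun b _ => hμμ b) (fun b _ => hμμ b) fun b _ => ?_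
    simp only [hμμ]
  have hB : ∀ x y, killingForm ℂ L x y = killingForm ℂ L y x :=
    fun x y => LieModule.traceForm_comm ℂ L L x y
  have hex : ∀ α, ∃ x, α ∈ Φ → x ∈ rootSpace' H α ∧ x ≠ 0 := by
    intro α
    by_cases hα : α ∈ Φ
    · obtain ⟨x, hx, hx0⟩ := (Submodule.ne_bot_iff _).mp ((hΦ α).mp hα).2
      exact ⟨x, fun _ => ⟨hx, hx0⟩⟩
    · exact ⟨0, fun h => absurd h hα⟩
  choose x hx using hex
  have hxx : ∀ α ∈ Φ, killingForm ℂ L (x α) (x (-α)) ≠ 0 := fun α hα =>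
    killingForm_ne_zero_of_mem_rootSpace' H (hΦ0 α hα) (hx α hα).1 (hx α hα).2
      (hx _ (hΦneg α hα)).1 (hx _ (hΦneg α hα)).2
  obtain ⟨e, he, heB⟩ : ∃ e : Module.Dual ℂ H → L, (∀ α ∈ Φ, e α ∈ rootSpace' H α ∧ e α ≠ 0) ∧
      ∀ α ∈ Φ, killingForm ℂ L (e α) (e (-α)) = 1 := by
    let e : Module.Dual ℂ H → L := fun α =>
      if Pos α then x α else (killingForm ℂ L (x (-α)) (x α))⁻¹ • x α
    have hpos : ∀ α ∈ Φ, Pos α → killingForm ℂ L (e α) (e (-α)) = 1 := by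
      intro α hα h
      simp only [e, if_pos h, if_neg (not_pos_neg α hα h), neg_neg, map_smul, smul_eq_mul]
      exact inv_mul_cancel₀ (hxx α hα)
    refine ⟨e, fun α hα => ?_, fun α hα => ?_⟩
    · by_cases h : Pos α
      · simpa only [e, if_pos h] using hx α hα
      · simp only [e, if_neg h]
        refine ⟨Submodule.smul_mem _ _ (hx α hα).1, smul_ne_zero (inv_ne_zero ?_) (hx α hα).2⟩
        simpa using hxx (-α) (hΦneg α hα)
    · rcases pos_or α hα with h | h
      · exact hpos α hα h
      · have := hpos (-α) (hΦneg α hα) h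
        rwa [neg_neg, hB] at this
  have hex : ∀ α, ∃ c : ℂ, α ∈ Φ → σ (e α) = c • e (σstar α) := by
    intro α
    by_cases hα : α ∈ Φ
    · obtain ⟨c, hc⟩ := exists_eq_smul_of_mem_rootSpace' H (hΦ0 _ (hΦstar α hα))
        (he _ (hΦstar α hα)).1 (he _ (hΦstar α hα)).2 (hmem α _ (he α hα).1)
      exact ⟨c, fun _ => hc⟩
    · exact ⟨0, fun h => absurd h hα⟩
  choose c hc using hex
  have hc_neg : ∀ α ∈ Φ, c α * c (-α) = 1 := by
    intro α hα
    have h1 := hkill (e α) (e (-α))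
    rw [heB α hα, hc α hα, hc _ (hΦneg α hα), hstar_neg, map_smul, map_smul, LinearMap.smul_apply,
      heB _ (hΦstar α hα), map_one, smul_eq_mul, smul_eq_mul] at h1
    linear_combination h1
  have hc_star : ∀ α ∈ Φ, (starRingEnd ℂ) (c α) * c (σstar α) = 1 := by
    intro α hα
    have h1 := hσσ (e α)
    rw [hc α hα, hσsmul, hc _ (hΦstar α hα), hstar_star, smul_smul] at h1
    refine smul_left_injective ℂ (he α hα).2 ?_
    simpa using h1
  have hc_μ : ∀ α ∈ Φ, c (-(σstar α)) = (starRingEnd ℂ) (c α) := by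
    intro α hα
    have h1 := hc_neg _ (hΦstar α hα)
    have h2 := hc_star α hα
    linear_combination (starRingEnd ℂ) (c α) * h1 - c (-(σstar α)) * h2
  have hc0 : ∀ α ∈ Φ, c α ≠ 0 := fun α hα h => by simpa [h] using hc_neg α hα
  have hΦμ : ∀ α ∈ Φ, -(σstar α) ∈ Φ := fun α hα => hΦneg _ (hΦstar α hα)
  let s : Module.Dual ℂ H → ℂ := fun α =>
    if -(σstar α) = α then (((√‖c α‖)⁻¹ : ℝ) : ℂ)
    else if WellOrderingRel α (-(σstar α)) then 1 else (c (-(σstar α)))⁻¹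
  have hs0 : ∀ α ∈ Φ, s α ≠ 0 := by
    intro α hα
    simp only [s]
    split_ifs with h1 h2
    · have := hc0 α hα
      simpa [Real.sqrt_eq_zero'] using this
    · exact one_ne_zero
    · exact inv_ne_zero (hc0 _ (hΦμ α hα))
  have hs : ∀ α ∈ Φ, (starRingEnd ℂ) (s α) * c α * s (-(σstar α)) = 1 ∨
      -(σstar α) = α ∧ (starRingEnd ℂ) (s α) * c α * s (-(σstar α)) = -1 := by
    intro α hα
    have hcα := hc0 α hα
    by_cases h : -(σstar α) = α
    · have hcr : (starRingEnd ℂ) (c α) = c α := by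
        rw [← hc_μ α hα, h]
      obtain ⟨r, hr⟩ := Complex.conj_eq_iff_real.mp hcr
      have hr0 : r ≠ 0 := by
        rintro rfl
        exact hcα (by simpa using hr)
      have h1 : (starRingEnd ℂ) (s α) * c α * s (-(σstar α)) = ((r / |r| : ℝ) : ℂ) := by
        rw [h]
        simp only [s, if_pos h, Complex.conj_ofReal, hr, Complex.norm_real, Real.norm_eq_abs]
        rw [← Complex.ofReal_mul, ← Complex.ofReal_mul]
        congr 1
        have h2 : √|r| * √|r| = |r| := Real.mul_self_sqrt (abs_nonneg r)
        have h3 : √|r| ≠ 0 := by simpa [Real.sqrt_eq_zero'] using hr0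
        have h4 : |r| ≠ 0 := abs_ne_zero.mpr hr0
        field_simp
        rw [sq, h2]
      rw [h1]
      rcases lt_or_gt_of_ne hr0 with h2 | h2
      · right
        refine ⟨h, ?_⟩
        rw [abs_of_neg h2, div_neg, div_self hr0]
        simp
      · left
        rw [abs_of_pos h2, div_self hr0]
        simp
    · left
      have h' : ¬ -(σstar (-(σstar α))) = -(σstar α) := by
        rw [hμμ]
        exact fun h1 => h h1.symm
      have hcμ := hc_μ α hα
      have hcμ0 := hc0 _ (hΦμ α hα)
      simp only [s, if_neg h, if_neg h', hμμ]
      rcases trichotomous_of WellOrderingRel α (-(σstar α)) with h1 | h1 | h1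
      · rw [if_pos h1, if_neg (asymm h1), map_one, one_mul, mul_inv_cancel₀ hcα]
      · exact absurd h1.symm h
      · rw [if_pos h1, if_neg (asymm h1), hcμ, ← map_inv₀, Complex.conj_conj, mul_one,
          inv_mul_cancel₀ hcα]
  let t : Module.Dual ℂ H → ℂ := fun α => if Pos α then s α else (s (-α))⁻¹
  have ht : ∀ α ∈ Φ, t α * t (-α) = 1 := by
    have hpos : ∀ α ∈ Φ, Pos α → t α * t (-α) = 1 := by
      intro α hα h
      simp only [t, if_pos h, if_neg (not_pos_neg α hα h), neg_neg]
      exact mul_inv_cancel₀ (hs0 α hα)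
    intro α hα
    rcases pos_or α hα with h | h
    · exact hpos α hα h
    · have := hpos (-α) (hΦneg α hα) h
      rwa [neg_neg, mul_comm] at this
  let d : Module.Dual ℂ H → ℂ := fun α => (starRingEnd ℂ) (t α) * c α * t (-(σstar α))
  have hd_neg : ∀ α ∈ Φ, d α * d (-α) = 1 := by
    intro α hα
    have h1 := ht α hα
    have h2 := ht _ (hΦstar α hα)
    have h3 := hc_neg α hα
    have h4 : (starRingEnd ℂ) (t α) * (starRingEnd ℂ) (t (-α)) = 1 := by
      rw [← map_mul, h1, map_one]
    simp only [d, hstar_neg, neg_neg]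
    linear_combination (c α * c (-α) * t (σstar α) * t (-(σstar α))) * h4
      + (t (σstar α) * t (-(σstar α))) * h3 + h2
  have hd : ∀ α ∈ Φ, d α = 1 ∨ -(σstar α) = α ∧ d α = -1 := by
    have hpos : ∀ α ∈ Φ, Pos α → d α = 1 ∨ -(σstar α) = α ∧ d α = -1 := by
      intro α hα h
      simpa only [d, t, if_pos h, if_pos (pos_μ α h)] using hs α hα
    intro α hα
    rcases pos_or α hα with h | h
    · exact hpos α hα h
    · have h1 := hd_neg α hα
      rcases hpos (-α) (hΦneg α hα) h with h2 | ⟨h2, h3⟩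
      · left
        rwa [h2, mul_one] at h1
      · right
        rw [hstar_neg, neg_inj] at h2
        refine ⟨h2, ?_⟩
        rw [h3] at h1
        linear_combination -h1
  have hsign : ∀ α ∈ Φ, ∀ a a' b b' : L, a ∈ rootSpace' H α → a ≠ 0 →
      b ∈ rootSpace' H α → killingForm ℂ L a a' = 1 → killingForm ℂ L b b' = 1 →
      σ a = (-1 : ℂ) • a' → σ b = (1 : ℂ) • b' → False := by
    intro α hα a a' b b' ha ha0 hb hA hb' h1 h2
    obtain ⟨r, rfl⟩ := exists_eq_smul_of_mem_rootSpace' H (hΦ0 α hα) ha ha0 hb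
    rw [one_smul] at h2
    rw [← h2, hσsmul, h1, map_smul, map_smul, map_smul, LinearMap.smul_apply, hA, smul_eq_mul,
      smul_eq_mul, smul_eq_mul] at hb'
    have h3 : ((-(Complex.normSq r) : ℝ) : ℂ) = ((1 : ℝ) : ℂ) := by
      push_cast
      rw [Complex.normSq_eq_conj_mul_self]
      linear_combination hb'
    have h4 := Complex.ofReal_injective h3
    linarith [Complex.normSq_nonneg r]
  have hsub : ∀ (e₁ e₂ : Module.Dual ℂ H → L) (T₁ T₂ : Set (Module.Dual ℂ H)),
      (∀ α ∈ Φ, e₁ α ∈ rootSpace' H α ∧ e₁ α ≠ 0) →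
      (∀ α ∈ Φ, killingForm ℂ L (e₁ α) (e₁ (-α)) = 1) →
      (∀ α ∈ Φ, σ (e₁ α) = (if α ∈ T₁ then (-1 : ℂ) else 1) • e₁ (σstar α)) →
      T₁ ⊆ {γ ∈ Φ | -(σstar γ) = γ} →
      (∀ α ∈ Φ, e₂ α ∈ rootSpace' H α ∧ e₂ α ≠ 0) →
      (∀ α ∈ Φ, killingForm ℂ L (e₂ α) (e₂ (-α)) = 1) →
      (∀ α ∈ Φ, σ (e₂ α) = (if α ∈ T₂ then (-1 : ℂ) else 1) • e₂ (σstar α)) → T₁ ⊆ T₂ := by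
    intro e₁ e₂ T₁ T₂ h₁ hB₁ hσ₁ hT₁ h₂ hB₂ hσ₂ α hα
    by_contra hα₂
    obtain ⟨hαΦ, hαμ⟩ := hT₁ hα
    have hstarα : σstar α = -α := neg_eq_iff_eq_neg.mp hαμ
    have k₁ := hσ₁ α hαΦ
    have k₂ := hσ₂ α hαΦ
    rw [if_pos hα, hstarα] at k₁
    rw [if_neg hα₂, hstarα] at k₂
    exact hsign α hαΦ _ _ _ _ (h₁ α hαΦ).1 (h₁ α hαΦ).2 (h₂ α hαΦ).1 (hB₁ α hαΦ)
      (hB₂ α hαΦ) k₁ k₂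
  have ht0 : ∀ α ∈ Φ, t α ≠ 0 := fun α hα => left_ne_zero_of_mul_eq_one (ht α hα)
  obtain ⟨T, hT_mem⟩ : ∃ T : Set (Module.Dual ℂ H),
      ∀ γ, γ ∈ T ↔ γ ∈ Φ ∧ -(σstar γ) = γ ∧ d γ = -1 :=
    ⟨{γ | γ ∈ Φ ∧ -(σstar γ) = γ ∧ d γ = -1}, fun _ => Iff.rfl⟩
  have hE : ∀ α ∈ Φ, t α • e α ∈ rootSpace' H α ∧ t α • e α ≠ 0 := fun α hα =>
    ⟨Submodule.smul_mem _ _ (he α hα).1, smul_ne_zero (ht0 α hα) (he α hα).2⟩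
  have hEB : ∀ α ∈ Φ, killingForm ℂ L (t α • e α) (t (-α) • e (-α)) = 1 := by
    intro α hα
    simp only [map_smul, LinearMap.smul_apply, heB α hα, smul_eq_mul, mul_one]
    linear_combination ht α hα
  have hT : T ⊆ {γ ∈ Φ | -(σstar γ) = γ} := fun γ hγ => ⟨((hT_mem γ).mp hγ).1, ((hT_mem γ).mp hγ).2.1⟩
  have hEσ : ∀ α ∈ Φ, σ (t α • e α) =
      (if α ∈ T then (-1 : ℂ) else 1) • (t (σstar α) • e (σstar α)) := by
    intro α hα
    have h1 : (if α ∈ T then (-1 : ℂ) else 1) = d α := by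
      split_ifs with h
      · exact ((hT_mem α).mp h).2.2.symm
      · rcases hd α hα with h2 | h2
        · exact h2.symm
        · exact absurd ((hT_mem α).mpr ⟨hα, h2⟩) h
    rw [h1, hσsmul, hc α hα, smul_smul, smul_smul]
    congr 1
    simp only [d]
    linear_combination -((starRingEnd ℂ) (t α) * c α) * ht _ (hΦstar α hα)
  refine ⟨fun α => t α • e α, T, hE, hEB, hT, hEσ, fun e' T' h₁ h₂ h₃ h₄ => ?_⟩
  exact (hsub e' _ T' T h₁ h₂ h₄ h₃ hE hEB hEσ).antisymm
    (hsub _ e' T T' hE hEB hEσ hT h₁ h₂ h₄)
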